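/- Let n ≥ 1, p ≥ 1, let 𝒮 = (S_0,…,S_{2n}) in 𝕊_p(ℝ) admit a representing measure, fix t ∈ ℝ, and let T_i, ℳ₁, the columns y_1,…,y_{(n+1)p} of ℳ₁, and the set A be as defined from the shifted moments. Let ℳ₁' be the submatrix of ℳ₁ consisting of its columns y_{p+1},…,y_{(n+1)p} (i.e., ℳ₁ with its first block column removed). Then rank ℳ₁' = rank ℳ₁ − Card{ i ∈ {1,…,p} : y_{np+i} ∉ span{y_1,…,y_{np+i−1}} } − Card A. -/

import Mathlib

open Finset Matrix

/-- The block Hankel moment matrix `ℳ₁ = (T_{i+j-2})_{i,j=1}^{n+1}`. -/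
def momentMatrix (n p : ℕ) (T : ℕ → Matrix (Fin p) (Fin p) ℝ) :
    Matrix (Fin (n + 1) × Fin p) (Fin (n + 1) × Fin p) ℝ :=
  fun ia jb => T (ia.1.1 + jb.1.1) ia.2 jb.2

/-- A (finitely atomic) representing measure for `S_0, …, S_{2n}`. -/
def IsRepMeasure (n p : ℕ) (S : ℕ → Matrix (Fin p) (Fin p) ℝ) (ℓ : ℕ)
    (x : Fin ℓ → ℝ) (A : Fin ℓ → Matrix (Fin p) (Fin p) ℝ) : Prop :=
  Function.Injective x ∧ (∀ j, (A j).PosSemidef) ∧ (∀ j, A j ≠ 0) ∧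
    ∀ i, i ≤ 2 * n → S i = ∑ j, x j ^ i • A j

/-- The shifted moments `T_i = ∑_{ℓ=0}^{i} C(i,ℓ)(-1)^ℓ t^ℓ S_{i-ℓ}`. -/
def shiftT (p : ℕ) (t : ℝ) (S : ℕ → Matrix (Fin p) (Fin p) ℝ) (i : ℕ) :
    Matrix (Fin p) (Fin p) ℝ :=
  ∑ l ∈ Finset.range (i + 1), ((i.choose l : ℝ) * (-1) ^ l * t ^ l) • S (i - l)

/-- The `j`-th column (1-based) of `ℳ₁ = (T_{i+j-2})_{i,j=1}^{n+1}`. -/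
def colM1 (n p : ℕ) (hp : 0 < p) (T : ℕ → Matrix (Fin p) (Fin p) ℝ) (j : ℕ) :
    Fin (n + 1) × Fin p → ℝ :=
  fun ia => T (ia.1.1 + (j - 1) / p) ia.2 ⟨(j - 1) % p, Nat.mod_lt _ hp⟩

/-- The index set `A` of Theorem 1.1. -/
def setA (n p : ℕ) (hp : 0 < p) (T : ℕ → Matrix (Fin p) (Fin p) ℝ) : Set ℕ :=
  {i | i ∈ Set.Icc 1 p ∧ ∃ k ∈ Set.Icc 1 n,
    colM1 n p hp T (k * p + i) ∈
      Submodule.span ℝ (colM1 n p hp T '' Set.Icc (p + 1) (k * p + i - 1)) ∧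
    colM1 n p hp T ((k - 1) * p + i) ∉
      Submodule.span ℝ (colM1 n p hp T '' Set.Icc 1 ((k - 1) * p + i - 1))}

/-- `ℳ₁' = ℳ₁` with its first block column removed, i.e. the block columns
`X¹, …, Xⁿ` of the moment matrix of `T`. -/
def momentMatrixTail (n p : ℕ) (T : ℕ → Matrix (Fin p) (Fin p) ℝ) :
    Matrix (Fin (n + 1) × Fin p) (Fin n × Fin p) ℝ :=
  fun ia jb => T (ia.1.1 + jb.1.1 + 1) ia.2 jb.2

section PivotIndices

variable {K V : Type*} [Field K] [AddCommGroup V] [Module K V]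

open Classical in
/-- The rank of a finite run of vectors is the number of vectors outside the span of their
predecessors in the run. -/
lemma finrank_span_image_Icc [FiniteDimensional K V] (y : ℕ → V) {a : ℕ} (ha : 1 ≤ a) (b : ℕ) :
    Module.finrank K (Submodule.span K (y '' Set.Icc a b)) =
      #{j ∈ Finset.Icc a b | y j ∉ Submodule.span K (y '' Set.Icc a (j - 1))} := by
  induction b with
  | zero =>
    have ha' : 0 < a := ha
    simp [Set.Icc_eq_empty_of_lt ha', Finset.Icc_eq_empty_of_lt ha']
  | succ b ih =>
    rcases Nat.lt_or_ge (b + 1) a with hab | hab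
    · simp [Set.Icc_eq_empty_of_lt hab, Finset.Icc_eq_empty_of_lt hab]
    have hset : Set.Icc a (b + 1) = insert (b + 1) (Set.Icc a b) := by
      ext j; simp only [Set.mem_Icc, Set.mem_insert_iff]; omega
    have hfin : Finset.Icc a (b + 1) = insert (b + 1) (Finset.Icc a b) := by
      ext j; simp only [Finset.mem_Icc, Finset.mem_insert]; omega
    rw [hset, hfin, Set.image_insert_eq, Finset.filter_insert, Nat.add_sub_cancel]
    by_cases hy : y (b + 1) ∈ Submodule.span K (y '' Set.Icc a b)
    · rw [Submodule.span_insert_eq_span hy, ih, if_neg (not_not.mpr hy)]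
    · rw [if_pos hy, Finset.card_insert_of_notMem (by simp), ← ih, Submodule.span_insert,
        sup_comm, Submodule.finrank_sup_span_singleton hy]

/-- If dependence of a vector on its predecessors propagates under the shift by `p`, with
dependence only on the shifted predecessors, then deleting the first `p` vectors lowers the rank
by the stated count of pivots. -/
lemma finrank_span_eq_finrank_span_tail_add [FiniteDimensional K V] (y : ℕ → V) (n p : ℕ)
    (hp : 0 < p)
    (hshift : ∀ j, 1 ≤ j → j ≤ n * p → y j ∈ Submodule.span K (y '' Set.Icc 1 (j - 1)) →
      y (j + p) ∈ Submodule.span K (y '' Set.Icc (p + 1) (j + p - 1))) :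
    Module.finrank K (Submodule.span K (y '' Set.Icc 1 ((n + 1) * p))) =
      Module.finrank K (Submodule.span K (y '' Set.Icc (p + 1) ((n + 1) * p))) +
      {i | i ∈ Set.Icc 1 p ∧
        y (n * p + i) ∉ Submodule.span K (y '' Set.Icc 1 (n * p + i - 1))}.ncard +
      {i | i ∈ Set.Icc 1 p ∧ ∃ k ∈ Set.Icc 1 n,
        y (k * p + i) ∈ Submodule.span K (y '' Set.Icc (p + 1) (k * p + i - 1)) ∧
        y ((k - 1) * p + i) ∉
          Submodule.span K (y '' Set.Icc 1 ((k - 1) * p + i - 1))}.ncard := by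
  classical
  have hmul : (n + 1) * p = n * p + p := by ring
  set P : ℕ → Prop := fun j => y j ∉ Submodule.span K (y '' Set.Icc 1 (j - 1))
  set Q : ℕ → Prop := fun j => y j ∉ Submodule.span K (y '' Set.Icc (p + 1) (j - 1))
  have hPQ : ∀ j, P j → Q j := fun j hj hmem => hj <| by
    refine Submodule.span_mono (Set.image_mono (Set.Icc_subset_Icc_left ?_)) hmem
    omega
  have hQP : ∀ j, 1 ≤ j → j ≤ n * p → Q (j + p) → P j := fun j h1 h2 hq hmem =>
    hq (hshift j h1 h2 hmem)
  have hlast : {i | i ∈ Set.Icc 1 p ∧ P (n * p + i)}.ncard =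
      #{j ∈ Finset.Icc (n * p + 1) (n * p + p) | P j} := by
    rw [← Set.ncard_coe_finset,
      ← Set.ncard_image_of_injective _ (add_right_injective (n * p))]
    congr 1
    ext j
    simp only [Set.mem_image, Set.mem_ofPred_eq, Set.mem_Icc, Finset.coe_filter, Finset.mem_Icc]
    constructor
    · rintro ⟨i, ⟨⟨h1, h2⟩, h3⟩, rfl⟩
      exact ⟨⟨by omega, by omega⟩, h3⟩
    · rintro ⟨⟨h1, h2⟩, h3⟩
      refine ⟨j - n * p, ⟨⟨by omega, by omega⟩, ?_⟩, by omega⟩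
      rwa [show n * p + (j - n * p) = j by omega]
  have hiter : ∀ j, 1 ≤ j → ¬ Q (j + p) → ∀ r, j + (r + 1) * p ≤ n * p + p →
      ¬ P (j + (r + 1) * p) := by
    intro j h1 hj r
    induction r with
    | zero => intro _ h; exact hj (hPQ _ (by simpa using h))
    | succ r ih =>
      intro hr h
      have e : j + (r + 1 + 1) * p = j + (r + 1) * p + p := by ring
      rw [e] at hr h
      exact ih (by omega) (hQP _ (by omega) (by omega) (hPQ _ h))
  have hA : {i | i ∈ Set.Icc 1 p ∧ ∃ k ∈ Set.Icc 1 n, ¬ Q (k * p + i) ∧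
      P ((k - 1) * p + i)}.ncard =
      #{j ∈ Finset.Icc 1 (n * p) | P j ∧ ¬ Q (j + p)} := by
    rw [← Finset.card_image_of_injOn (f := fun j => (j - 1) % p + 1), ← Set.ncard_coe_finset]
    · congr 1
      ext i
      simp only [Set.mem_image, Set.mem_ofPred_eq, Set.mem_Icc, Finset.coe_image,
        Finset.coe_filter, Finset.mem_Icc]
      constructor
      · rintro ⟨⟨h1, h2⟩, k, ⟨h3, h4⟩, h5, h6⟩
        obtain ⟨k, rfl⟩ := Nat.exists_eq_add_of_le' h3
        rw [Nat.add_sub_cancel] at h6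
        have hk : (k + 1) * p ≤ n * p := Nat.mul_le_mul_right p h4
        have e : (k + 1) * p = k * p + p := by ring
        refine ⟨k * p + i, ⟨⟨by omega, by omega⟩, h6, ?_⟩, ?_⟩
        · rwa [show k * p + i + p = (k + 1) * p + i by omega]
        · rw [show k * p + i - 1 = (i - 1) + k * p by omega, Nat.add_mul_mod_self_right,
            Nat.mod_eq_of_lt (by omega)]
          omega
      · rintro ⟨j, ⟨⟨h1, h2⟩, h3, h4⟩, rfl⟩
        have hlt := Nat.mod_lt (j - 1) hp
        have hdm := Nat.div_add_mod' (j - 1) p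
        refine ⟨⟨by omega, by omega⟩, (j - 1) / p + 1, ⟨Nat.le_add_left 1 _, ?_⟩, ?_, ?_⟩
        · exact (Nat.div_lt_iff_lt_mul hp).mpr (by omega)
        · rwa [show ((j - 1) / p + 1) * p + ((j - 1) % p + 1) = j + p by rw [add_mul]; omega]
        · rwa [Nat.add_sub_cancel, show (j - 1) / p * p + ((j - 1) % p + 1) = j by omega]
    · have key : ∀ i j, 1 ≤ i → j ≤ n * p → ¬ Q (i + p) → P j → i < j →
          (i - 1) % p ≠ (j - 1) % p := by
        intro i j hi hj hq hPj hij hmod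
        obtain ⟨r, hr⟩ := (Nat.modEq_iff_dvd' (show i - 1 ≤ j - 1 by omega)).mp hmod
        rcases r with _ | r
        · omega
        have e : j = i + (r + 1) * p := by rw [mul_comm]; omega
        exact hiter i hi hq r (by omega) (e ▸ hPj)
      intro i hi j hj hij
      simp only [Finset.coe_filter, Finset.mem_Icc, Set.mem_ofPred_eq] at hi hj
      have hmod : (i - 1) % p = (j - 1) % p := by simpa using hij
      rcases lt_trichotomy i j with h | h | h
      · exact absurd hmod (key i j hi.1.1 hj.1.2 hi.2.2 hj.2.1 h)
      · exact h
      · exact absurd hmod.symm (key j i hj.1.1 hi.1.2 hj.2.2 hi.2.1 h)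
  have htail : #{j ∈ Finset.Icc (p + 1) (n * p + p) | Q j} =
      #{j ∈ Finset.Icc 1 (n * p) | P j ∧ Q (j + p)} := by
    rw [← Finset.card_image_of_injective
      {j ∈ Finset.Icc 1 (n * p) | P j ∧ Q (j + p)} (add_left_injective p)]
    congr 1
    ext j
    simp only [Finset.mem_image, Finset.mem_filter, Finset.mem_Icc]
    constructor
    · rintro ⟨⟨h1, h2⟩, h3⟩
      have e : j - p + p = j := by omega
      exact ⟨j - p, ⟨⟨by omega, by omega⟩, hQP _ (by omega) (by omega) (e.symm ▸ h3),
        e.symm ▸ h3⟩, e⟩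
    · rintro ⟨i, ⟨⟨h1, h2⟩, -, h3⟩, rfl⟩
      exact ⟨⟨by omega, by omega⟩, h3⟩
  have hsplit : #{j ∈ Finset.Icc 1 (n * p + p) | P j} =
      #{j ∈ Finset.Icc 1 (n * p) | P j} +
      #{j ∈ Finset.Icc (n * p + 1) (n * p + p) | P j} := by
    rw [← Finset.card_union_of_disjoint, ← Finset.filter_union]
    · congr 2
      ext j; simp only [Finset.mem_Icc, Finset.mem_union]; omega
    · rw [Finset.disjoint_left]
      intro j; simp only [Finset.mem_filter, Finset.mem_Icc]; omega
  have hhead := Finset.card_filter_add_card_filter_not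
    (s := {j ∈ Finset.Icc 1 (n * p) | P j}) (fun j => Q (j + p))
  rw [Finset.filter_filter, Finset.filter_filter] at hhead
  rw [finrank_span_image_Icc y le_rfl, finrank_span_image_Icc y (Nat.le_add_left 1 p), hmul]
  change #{j ∈ Finset.Icc 1 (n * p + p) | P j} =
    #{j ∈ Finset.Icc (p + 1) (n * p + p) | Q j} + _ + _
  have hmem : ∀ j, y j ∈ Submodule.span K (y '' Set.Icc (p + 1) (j - 1)) ↔ ¬ Q j := fun j =>
    not_not.symm
  simp only [hmem]
  rw [hlast, hsplit, htail, hA, ← hhead]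
  omega

end PivotIndices

section MomentColumns

variable {n p : ℕ} {T : ℕ → Matrix (Fin p) (Fin p) ℝ}

lemma rank_momentMatrix_eq_finrank_span (hp : 0 < p) :
    (momentMatrix n p T).rank =
      Module.finrank ℝ (Submodule.span ℝ (colM1 n p hp T '' Set.Icc 1 ((n + 1) * p))) := by
  rw [rank_eq_finrank_span_cols]
  suffices hcols : Set.range (momentMatrix n p T).col =
      colM1 n p hp T '' Set.Icc 1 ((n + 1) * p) by rw [hcols]
  ext v
  simp only [Set.mem_range, Set.mem_image, Set.mem_Icc, Prod.exists]
  constructor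
  · rintro ⟨k, b, rfl⟩
    have hk : k.1 * p ≤ n * p := Nat.mul_le_mul_right p (by omega)
    refine ⟨k * p + b + 1, ⟨by omega, by rw [add_mul]; omega⟩, ?_⟩
    funext ia
    simp only [colM1, momentMatrix, Matrix.col_apply, Nat.add_sub_cancel]
    have h1 : (k.1 * p + b) / p = k := by
      rw [mul_comm, Nat.mul_add_div hp, Nat.div_eq_of_lt b.2, add_zero]
    have h2 : (k.1 * p + b) % p = b := by
      rw [mul_comm, Nat.mul_add_mod, Nat.mod_eq_of_lt b.2]
    simp only [h1, h2]
  · rintro ⟨j, ⟨h1, h2⟩, rfl⟩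
    exact ⟨⟨(j - 1) / p, (Nat.div_lt_iff_lt_mul hp).mpr (by omega)⟩,
      ⟨(j - 1) % p, Nat.mod_lt _ hp⟩, rfl⟩

lemma rank_momentMatrixTail_eq_finrank_span (hp : 0 < p) :
    (momentMatrixTail n p T).rank =
      Module.finrank ℝ
        (Submodule.span ℝ (colM1 n p hp T '' Set.Icc (p + 1) ((n + 1) * p))) := by
  rw [rank_eq_finrank_span_cols]
  suffices hcols : Set.range (momentMatrixTail n p T).col =
      colM1 n p hp T '' Set.Icc (p + 1) ((n + 1) * p) by rw [hcols]
  ext v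
  simp only [Set.mem_range, Set.mem_image, Set.mem_Icc, Prod.exists]
  constructor
  · rintro ⟨k, b, rfl⟩
    have hk : (k.1 + 1) * p ≤ n * p := Nat.mul_le_mul_right p (by omega)
    have e : (k.1 + 1) * p = k * p + p := by ring
    refine ⟨(k + 1) * p + b + 1, ⟨by omega, by rw [add_mul n]; omega⟩, ?_⟩
    funext ia
    simp only [colM1, momentMatrixTail, Matrix.col_apply, Nat.add_sub_cancel]
    have h1 : ((k.1 + 1) * p + b) / p = k + 1 := by
      rw [mul_comm, Nat.mul_add_div hp, Nat.div_eq_of_lt b.2, add_zero]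
    have h2 : ((k.1 + 1) * p + b) % p = b := by
      rw [mul_comm, Nat.mul_add_mod, Nat.mod_eq_of_lt b.2]
    simp only [h1, h2, add_assoc]
  · rintro ⟨j, ⟨h1, h2⟩, rfl⟩
    have hlt : (j - 1) / p < n + 1 := (Nat.div_lt_iff_lt_mul hp).mpr (by omega)
    have hpos : 1 ≤ (j - 1) / p := (Nat.le_div_iff_mul_le hp).mpr (by omega)
    refine ⟨⟨(j - 1) / p - 1, by omega⟩, ⟨(j - 1) % p, Nat.mod_lt _ hp⟩, ?_⟩
    funext ia
    simp only [colM1, momentMatrixTail, Matrix.col_apply]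
    rw [show ia.1.1 + ((j - 1) / p - 1) + 1 = ia.1.1 + (j - 1) / p by omega]

/-- The shifted moments are the moments of the translated atoms. -/
lemma shiftT_eq_sum_of_isRepMeasure {S : ℕ → Matrix (Fin p) (Fin p) ℝ} {ℓ : ℕ}
    {x : Fin ℓ → ℝ} {A : Fin ℓ → Matrix (Fin p) (Fin p) ℝ}
    (h : IsRepMeasure n p S ℓ x A) (t : ℝ) {i : ℕ} (hi : i ≤ 2 * n) :
    shiftT p t S i = ∑ j, (x j - t) ^ i • A j := by
  have hS : ∀ l, S (i - l) = ∑ j, x j ^ (i - l) • A j := fun l => h.2.2.2 _ (by omega)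
  simp only [shiftT, hS, Finset.smul_sum, smul_smul]
  rw [Finset.sum_comm]
  refine Finset.sum_congr rfl fun j _ => ?_
  rw [← Finset.sum_smul, show x j - t = -t + x j by ring, add_pow]
  congr 1
  refine Finset.sum_congr rfl fun l _ => ?_
  rw [neg_pow t l]
  ring

/-- A column of the moment matrix of a positive atomic measure that depends on its predecessors
stays dependent on the shifted predecessors after multiplication by the variable. -/
lemma colM1_add_mem_span (hp : 0 < p) {ℓ : ℕ} {x : Fin ℓ → ℝ}
    {A : Fin ℓ → Matrix (Fin p) (Fin p) ℝ} (hA : ∀ j, (A j).PosSemidef)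
    (hT : ∀ i ≤ 2 * n, T i = ∑ j, x j ^ i • A j) {m : ℕ} (hm : 1 ≤ m) (hmn : m ≤ n * p)
    (hmem : colM1 n p hp T m ∈ Submodule.span ℝ (colM1 n p hp T '' Set.Icc 1 (m - 1))) :
    colM1 n p hp T (m + p) ∈
      Submodule.span ℝ (colM1 n p hp T '' Set.Icc (p + 1) (m + p - 1)) := by
  let g : ℕ → Fin ℓ → Fin p → ℝ := fun m j =>
    x j ^ ((m - 1) / p) • Pi.single ⟨(m - 1) % p, Nat.mod_lt _ hp⟩ 1
  let D : (Fin ℓ → Fin p → ℝ) →ₗ[ℝ] (Fin ℓ → Fin p → ℝ) :=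
    LinearMap.pi fun j => (A j).mulVecLin ∘ₗ LinearMap.proj j
  let X : (Fin ℓ → Fin p → ℝ) →ₗ[ℝ] (Fin ℓ → Fin p → ℝ) :=
    LinearMap.pi fun j => x j • LinearMap.proj j
  let Φ : (Fin ℓ → Fin p → ℝ) →ₗ[ℝ] (Fin (n + 1) × Fin p → ℝ) :=
    LinearMap.pi fun ia => ∑ j, x j ^ ia.1.1 •
      ((LinearMap.proj ia.2 : (Fin p → ℝ) →ₗ[ℝ] ℝ) ∘ₗ LinearMap.proj j)
  have hmul : (n + 1) * p = n * p + p := by ring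
  have hΦ : ∀ j ≤ (n + 1) * p, colM1 n p hp T j = Φ (D (g j)) := by
    intro j hj
    have hdiv : (j - 1) / p < n + 1 := (Nat.div_lt_iff_lt_mul hp).mpr (by omega)
    funext ia
    have := ia.1.2
    simp [colM1, Φ, D, g, hT (ia.1 + (j - 1) / p) (by omega), Matrix.sum_apply,
      pow_add, mul_assoc]
  have hX : ∀ j, 1 ≤ j → D (g (j + p)) = X (D (g j)) := by
    intro j hj
    funext i b
    have e : j + p - 1 = j - 1 + p := by omega
    simp [X, D, g, e, Nat.add_div_right _ hp, pow_succ', mul_assoc]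
  have hker : ∀ u ∈ Submodule.span ℝ (g '' Set.Icc 1 ((n + 1) * p)),
      Φ (D u) = 0 → D u = 0 := by
    intro u hu h0
    have horth : ∀ v ∈ Submodule.span ℝ (g '' Set.Icc 1 ((n + 1) * p)),
        ∑ j, v j ⬝ᵥ D u j = 0 := by
      intro v hv
      induction hv using Submodule.span_induction with
      | mem v hv =>
        obtain ⟨j, hj, rfl⟩ := hv
        have hdiv : (j - 1) / p < n + 1 := (Nat.div_lt_iff_lt_mul hp).mpr (by
          have := hj.1; have := hj.2; omega)
        have := congrFun h0 (⟨(j - 1) / p, hdiv⟩, ⟨(j - 1) % p, Nat.mod_lt _ hp⟩)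
        simpa [Φ, g] using this
      | zero => simp
      | add v w _ _ hv hw => simp [add_dotProduct, Finset.sum_add_distrib, hv, hw]
      | smul c v _ hv => simp [smul_dotProduct, ← Finset.mul_sum, hv]
    have hsum := horth u hu
    have hnonneg : ∀ j ∈ Finset.univ, 0 ≤ u j ⬝ᵥ D u j := fun j _ => by
      simpa [D] using (hA j).dotProduct_mulVec_nonneg (u j)
    funext j
    have hj := (Finset.sum_eq_zero_iff_of_nonneg hnonneg).mp hsum j (Finset.mem_univ j)
    exact ((hA j).dotProduct_mulVec_zero_iff (u j)).mp (by simpa [D] using hj)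
  have himage : colM1 n p hp T '' Set.Icc 1 (m - 1) = (Φ ∘ₗ D) '' (g '' Set.Icc 1 (m - 1)) := by
    rw [Set.image_image]
    refine Set.image_congr fun j hj => hΦ j ?_
    have := hj.2; omega
  rw [himage, Submodule.span_image, hΦ m (by omega)] at hmem
  obtain ⟨u, hu, hum⟩ := hmem
  have hDu : D u = D (g m) := by
    rw [← sub_eq_zero, ← map_sub]
    refine hker _ (Submodule.sub_mem _ ?_ ?_) ?_
    · refine Submodule.span_mono (Set.image_mono (Set.Icc_subset_Icc_right ?_)) hu
      omega
    · exact Submodule.subset_span ⟨m, ⟨hm, by omega⟩, rfl⟩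
    · rw [map_sub, map_sub, sub_eq_zero]; exact hum
  have hmem' : Φ (X (D u)) ∈ (Submodule.span ℝ (g '' Set.Icc 1 (m - 1))).map (Φ ∘ₗ X ∘ₗ D) :=
    ⟨u, hu, rfl⟩
  rw [hΦ (m + p) (by omega), hX m hm, ← hDu]
  rw [← Submodule.span_image, Set.image_image] at hmem'
  refine Submodule.span_mono ?_ hmem'
  rintro _ ⟨j, ⟨h1, h2⟩, rfl⟩
  refine ⟨j + p, ⟨by omega, by omega⟩, ?_⟩
  rw [hΦ (j + p) (by omega), hX j h1]
  rfl

end MomentColumns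

/-- **Claim 1, equation (3.2)**: `rank ℳ₁' = rank ℳ₁ - p₀ - Card A`, where `p₀` is the
number of indices `i ∈ {1,…,p}` such that the `i`-th column of the last block column of
`ℳ₁` is independent of all previous columns. -/
theorem rank_tail_moment_matrix (n p : ℕ) (hn : 1 ≤ n) (hp : 0 < p)
    (S : ℕ → Matrix (Fin p) (Fin p) ℝ) (hsymm : ∀ i, i ≤ 2 * n → (S i).IsSymm)
    (hrep : ∃ ℓ x A, IsRepMeasure n p S ℓ x A) (t : ℝ) :
    (momentMatrixTail n p (shiftT p t S)).rank =
      (momentMatrix n p (shiftT p t S)).rank -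
        ({i | i ∈ Set.Icc 1 p ∧
          colM1 n p hp (shiftT p t S) (n * p + i) ∉
            Submodule.span ℝ
              (colM1 n p hp (shiftT p t S) '' Set.Icc 1 (n * p + i - 1))}).ncard -
        (setA n p hp (shiftT p t S)).ncard := by
  obtain ⟨ℓ, x, A, h⟩ := hrep
  have hrank := finrank_span_eq_finrank_span_tail_add (colM1 n p hp (shiftT p t S)) n p hp
    fun m hm hmn => colM1_add_mem_span hp h.2.1
      (fun i hi => shiftT_eq_sum_of_isRepMeasure h t hi) hm hmn
  rw [rank_momentMatrix_eq_finrank_span hp, rank_momentMatrixTail_eq_finrank_span hp, hrank,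
    setA]
  omega
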